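/- For every positive integer n, the number of restricted Laguerre histories of length n equals n!; equivalently, there is a bijection between the set of permutations of {1,…,n} and the set ℒ_n of restricted Laguerre histories of length n. -/

import Mathlib

/-- A step of a two-colored Motzkin path: up `U`, down `D`, or a horizontal step
of one of two colors `H`, `H̃`. -/
inductive LStep where
  | U : LStep
  | D : LStep
  | H : LStep
  | Ht : LStep
deriving DecidableEq

/-- Number of up steps among the first `i` steps of `m`. -/
def lUp (n : ℕ) (m : Fin n → LStep) (i : ℕ) : ℕ :=
  (Finset.univ.filter (fun j : Fin n => (j : ℕ) < i ∧ m j = LStep.U)).card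

/-- Number of down steps among the first `i` steps of `m`. -/
def lDown (n : ℕ) (m : Fin n → LStep) (i : ℕ) : ℕ :=
  (Finset.univ.filter (fun j : Fin n => (j : ℕ) < i ∧ m j = LStep.D)).card

/-- A two-colored Motzkin path of length `n`: every prefix has at least as many up steps
as down steps, and the total numbers of up and down steps are equal. -/
def IsMotzkin2 (n : ℕ) (m : Fin n → LStep) : Prop :=
  (∀ i ≤ n, lDown n m i ≤ lUp n m i) ∧ lUp n m n = lDown n m n

/-- A restricted Laguerre history `(M, w)`: a two-colored Motzkin path `M` with labels
satisfying `0 ≤ wᵢ ≤ hᵢ(M)` if the `i`-th step is `U` or `H`, and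
`0 ≤ wᵢ ≤ hᵢ(M) - 1` if it is `D` or `H̃`, where `hᵢ(M) = lUp - lDown` is the height
of the `i`-th step. -/
def IsRLH (n : ℕ) (mw : (Fin n → LStep) × (Fin n → ℕ)) : Prop :=
  IsMotzkin2 n mw.1 ∧
  ∀ i : Fin n,
    if mw.1 i = LStep.U ∨ mw.1 i = LStep.H then
      mw.2 i + lDown n mw.1 i ≤ lUp n mw.1 i
    else
      mw.2 i + 1 + lDown n mw.1 i ≤ lUp n mw.1 i

/-- A Laguerre history ending at height `h`: like a restricted Laguerre history, except that
the underlying path ends at height `h` instead of `0`. -/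
def IsLaguerreTo (n h : ℕ) (mw : (Fin n → LStep) × (Fin n → ℕ)) : Prop :=
  lUp n mw.1 n = lDown n mw.1 n + h ∧
  ∀ i : Fin n,
    if mw.1 i = LStep.U ∨ mw.1 i = LStep.H then
      mw.2 i + lDown n mw.1 i ≤ lUp n mw.1 i
    else
      mw.2 i + 1 + lDown n mw.1 i ≤ lUp n mw.1 i

theorem isRLH_iff_isLaguerreTo_zero (n : ℕ) (mw : (Fin n → LStep) × (Fin n → ℕ)) :
    IsRLH n mw ↔ IsLaguerreTo n 0 mw := by
  refine ⟨fun h => ⟨h.1.2, h.2⟩, fun h => ⟨⟨fun i hi => ?_, h.1⟩, h.2⟩⟩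
  obtain rfl | hlt := hi.eq_or_lt
  · exact h.1.ge
  · have hw := h.2 ⟨i, hlt⟩
    split_ifs at hw <;> simp only at hw <;> omega

theorem card_filter_snoc {α : Type*} [DecidableEq α] (n : ℕ) (m : Fin n → α) (s t : α) (i : ℕ) :
    (Finset.univ.filter (fun j : Fin (n + 1) =>
      (j : ℕ) < i ∧ (Fin.snoc m s : Fin (n + 1) → α) j = t)).card =
    (Finset.univ.filter (fun j : Fin n => (j : ℕ) < i ∧ m j = t)).card +
      if n < i ∧ s = t then 1 else 0 := by
  simp only [Finset.card_filter, Fin.sum_univ_castSucc, Fin.snoc_castSucc, Fin.snoc_last,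
    Fin.val_castSucc, Fin.val_last]

theorem lUp_snoc (n : ℕ) (m : Fin n → LStep) (s : LStep) (i : ℕ) :
    lUp (n + 1) (Fin.snoc m s : Fin (n + 1) → LStep) i =
      lUp n m i + if n < i ∧ s = LStep.U then 1 else 0 :=
  card_filter_snoc n m s LStep.U i

theorem lDown_snoc (n : ℕ) (m : Fin n → LStep) (s : LStep) (i : ℕ) :
    lDown (n + 1) (Fin.snoc m s : Fin (n + 1) → LStep) i =
      lDown n m i + if n < i ∧ s = LStep.D then 1 else 0 :=
  card_filter_snoc n m s LStep.D i

theorem lUp_succ_self (n : ℕ) (m : Fin n → LStep) : lUp n m (n + 1) = lUp n m n := by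
  unfold lUp
  congr 1
  ext j
  simp

theorem lDown_succ_self (n : ℕ) (m : Fin n → LStep) : lDown n m (n + 1) = lDown n m n := by
  unfold lDown
  congr 1
  ext j
  simp

/-- The height from which a step `s` arrives at height `h`. -/
def LStep.source (h : ℕ) : LStep → ℕ
  | .U => h - 1
  | .D => h + 1
  | .H => h
  | .Ht => h

/-- The number of labels available to a step `s` arriving at height `h`. -/
def LStep.labels (h : ℕ) : LStep → ℕ
  | .U => h
  | .D => h + 1
  | .H => h + 1
  | .Ht => h

theorem isLaguerreTo_snoc_iff (n h : ℕ) (m : Fin n → LStep) (w : Fin n → ℕ) (s : LStep) (a : ℕ) :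
    IsLaguerreTo (n + 1) h (Fin.snoc m s, Fin.snoc w a) ↔
      IsLaguerreTo n (s.source h) (m, w) ∧ a < s.labels h := by
  unfold IsLaguerreTo
  have hlt (i : Fin n) : ¬ n < (i : ℕ) := i.isLt.le.not_gt
  simp only [Fin.forall_fin_succ', Fin.snoc_castSucc, Fin.snoc_last, lUp_snoc, lDown_snoc,
    Fin.val_castSucc, Fin.val_last, lUp_succ_self, lDown_succ_self, hlt, lt_irrefl,
    Nat.lt_succ_self, true_and, false_and, if_false, add_zero]
  generalize (∀ i : Fin n, _) = p
  by_cases hp : p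
  · cases s <;> simp [LStep.source, LStep.labels, hp] <;> omega
  · simp [hp]

/-- Removing the last step of a Laguerre history. -/
def laguerreToSuccEquiv (n h : ℕ) :
    {mw // IsLaguerreTo (n + 1) h mw} ≃
      Σ s : LStep, {mw // IsLaguerreTo n (s.source h) mw} × Fin (s.labels h) where
  toFun x :=
    have hx := (isLaguerreTo_snoc_iff n h (Fin.init x.1.1) (Fin.init x.1.2)
      (x.1.1 (Fin.last n)) (x.1.2 (Fin.last n))).1 (by simpa using x.2)
    ⟨x.1.1 (Fin.last n), ⟨(Fin.init x.1.1, Fin.init x.1.2), hx.1⟩, ⟨x.1.2 (Fin.last n), hx.2⟩⟩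
  invFun y :=
    ⟨(Fin.snoc y.2.1.1.1 y.1, Fin.snoc y.2.1.1.2 y.2.2),
      (isLaguerreTo_snoc_iff n h _ _ _ _).2 ⟨y.2.1.2, y.2.2.2⟩⟩
  left_inv x := by simp
  right_inv := by
    rintro ⟨s, ⟨⟨m, w⟩, hmw⟩, a, ha⟩
    refine Sigma.ext (by simp) ?_
    dsimp only
    congr! <;> simp

instance : Fintype LStep where
  elems := {.U, .D, .H, .Ht}
  complete s := by cases s <;> decide

theorem choose_three_term (n h : ℕ) :
    n.choose (h - 1) * h + n.choose (h + 1) * (h + 1) + n.choose h * (h + 1) + n.choose h * h =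
      (n + 1) * (n + 1).choose h := by
  have hsucc := Nat.add_one_mul_choose_eq n h
  rw [Nat.choose_succ_succ] at hsucc
  cases h with
  | zero => simp
  | succ k =>
    have hk := Nat.choose_succ_succ n k
    have hk' := Nat.add_one_mul_choose_eq n k
    simp only [Nat.succ_eq_add_one, Nat.add_sub_cancel] at *
    nlinarith

theorem finite_and_card_isLaguerreTo (n h : ℕ) :
    Finite {mw // IsLaguerreTo n h mw} ∧
      Nat.card {mw // IsLaguerreTo n h mw} = n.factorial * n.choose h := by
  induction n generalizing h with
  | zero =>
    refine ⟨inferInstance, ?_⟩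
    cases h <;> simp [IsLaguerreTo, lUp, lDown]
  | succ n ih =>
    have hfin (k : ℕ) : Finite {mw // IsLaguerreTo n k mw} := (ih k).1
    refine ⟨Finite.of_equiv _ (laguerreToSuccEquiv n h).symm, ?_⟩
    rw [Nat.card_congr (laguerreToSuccEquiv n h), Nat.card_sigma]
    have huniv : (Finset.univ : Finset LStep) = {.U, .D, .H, .Ht} := rfl
    simp only [Nat.card_prod, Nat.card_fin, (ih _).2, huniv]
    simp [LStep.source, LStep.labels]
    rw [Nat.factorial_succ]
    linear_combination n.factorial * choose_three_term n h

/-- The number of restricted Laguerre histories of length `n` is `n!`;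
equivalently, there is a bijection between `𝔖ₙ` and `ℒₙ`. -/
theorem rlh_card_eq_factorial (n : ℕ) (hn : 0 < n) :
    Nat.card {mw : (Fin n → LStep) × (Fin n → ℕ) // IsRLH n mw} = n.factorial ∧
    Nonempty (Equiv.Perm (Fin n) ≃ {mw : (Fin n → LStep) × (Fin n → ℕ) // IsRLH n mw}) := by
  obtain ⟨hfin, hcard⟩ := finite_and_card_isLaguerreTo n 0
  have e : {mw // IsRLH n mw} ≃ {mw // IsLaguerreTo n 0 mw} :=
    Equiv.subtypeEquivRight (isRLH_iff_isLaguerreTo_zero n)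
  have : Finite {mw // IsRLH n mw} := Finite.of_equiv _ e.symm
  have hfact : Nat.card {mw // IsRLH n mw} = n.factorial := by
    rw [Nat.card_congr e, hcard, Nat.choose_zero_right, mul_one]
  exact ⟨hfact, Finite.card_eq.1 (by rw [hfact, Nat.card_perm, Nat.card_fin])⟩
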